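/- Define T : C(X) → C(X), where X = ∂D ∪ {1/n : n ≥ 2} ∪ {0}, by (Tf)(e^{iθ}) = f(e^{i(θ+√2)}) for e^{iθ} ∈ ∂D, (Tf)(1/2) = -f(1)/2 - f(e^{-i√2})/2, (Tf)(1/n) = -f(1/(n-1)) for n ≥ 3, and (Tf)(0) = -f(0). Then for every f ∈ C(X), the function Tf is continuous on X, and T is a linear isometry of C(X). -/

import Mathlib

open Complex

attribute [local instance] Classical.propDecidable

/-- The compact set `X = ∂D ∪ {1/n : n ≥ 2} ∪ {0}` in `ℂ`. -/
def Xset : Set ℂ :=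
  Metric.sphere (0 : ℂ) 1 ∪ {z : ℂ | ∃ n : ℕ, 2 ≤ n ∧ z = ((n : ℂ))⁻¹} ∪ {(0 : ℂ)}

/-- The operator of the example: `(Tf)(e^{iθ}) = f(e^{i(θ+√2)})`,
`(Tf)(1/2) = -f(1)/2 - f(e^{-i√2})/2`, `(Tf)(1/n) = -f(1/(n-1))` for `n ≥ 3`,
`(Tf)(0) = -f(0)`. -/
noncomputable def Tfun (f : ℂ → ℂ) (z : ℂ) : ℂ :=
  if z ∈ Metric.sphere (0 : ℂ) 1 then f (z * Complex.exp (Complex.I * Real.sqrt 2))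
  else if z = ((2 : ℂ))⁻¹ then
    -f 1 / 2 - f (Complex.exp (-Complex.I * Real.sqrt 2)) / 2
  else if h : ∃ n : ℕ, 3 ≤ n ∧ z = ((n : ℂ))⁻¹ then -f (((h.choose : ℂ) - 1)⁻¹)
  else if z = 0 then -f 0
  else 0

lemma Xset_cases {z : ℂ} (hz : z ∈ Xset) :
    ‖z‖ = 1 ∨ z = 2⁻¹ ∨ (∃ n : ℕ, 3 ≤ n ∧ z = (n : ℂ)⁻¹) ∨ z = 0 := by
  rcases hz with (h | ⟨n, hn, h⟩) | h
  · left; simpa using h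
  · rcases Nat.eq_or_lt_of_le hn with h2 | h2
    · right; left; rw [h, ← h2]; norm_num
    · right; right; left; exact ⟨n, h2, h⟩
  · right; right; right; exact h

lemma norm_inv_le {n : ℕ} (hn : 3 ≤ n) : ‖(n : ℂ)⁻¹‖ ≤ 1 / 3 := by
  rw [norm_inv, Complex.norm_natCast, one_div]
  have : (3 : ℝ) ≤ n := by exact_mod_cast hn
  gcongr

lemma norm_half : ‖(2 : ℂ)⁻¹‖ = 1 / 2 := by simp

lemma norm_rot : ‖Complex.exp (Complex.I * Real.sqrt 2)‖ = 1 := by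
  rw [mul_comm]; exact Complex.norm_exp_ofReal_mul_I _

lemma norm_rot' : ‖Complex.exp (-Complex.I * Real.sqrt 2)‖ = 1 := by
  have := Complex.norm_exp_ofReal_mul_I (-Real.sqrt 2)
  rw [← this]; congr 2; push_cast; ring

lemma mem_of_norm {z : ℂ} (h : ‖z‖ = 1) : z ∈ Xset := by
  left; left; simpa using h

lemma inv_mem {n : ℕ} (hn : 2 ≤ n) : (n : ℂ)⁻¹ ∈ Xset := Or.inl (Or.inr ⟨n, hn, rfl⟩)

lemma zero_mem' : (0 : ℂ) ∈ Xset := Or.inr rfl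

lemma T_circle (f : ℂ → ℂ) {z : ℂ} (h : ‖z‖ = 1) :
    Tfun f z = f (z * Complex.exp (Complex.I * Real.sqrt 2)) := by
  unfold Tfun; rw [if_pos (by simpa using h)]

lemma T_half (f : ℂ → ℂ) :
    Tfun f 2⁻¹ = -f 1 / 2 - f (Complex.exp (-Complex.I * Real.sqrt 2)) / 2 := by
  unfold Tfun
  rw [if_neg (by simp), if_pos rfl]

lemma small_mem {z : ℂ} (hz : z ∈ Xset) (h : ‖z‖ < 1 / 2) : z / (1 - z) ∈ Xset := by
  rcases Xset_cases hz with h1 | h1 | ⟨n, hn, h1⟩ | h1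
  · linarith
  · rw [h1, norm_half] at h; linarith
  · have : z / (1 - z) = ((n - 1 : ℕ) : ℂ)⁻¹ := by
      have h3 : (n : ℂ) ≠ 0 := by exact_mod_cast (by omega : n ≠ 0)
      rw [Nat.cast_sub (by omega), h1]
      have h4 : (1 : ℂ) - (n : ℂ)⁻¹ = (n - 1) * (n : ℂ)⁻¹ := by field_simp
      rw [h4, div_eq_mul_inv, mul_inv, inv_inv, mul_comm, mul_assoc, mul_inv_cancel₀ h3]
      simp
    rw [this]; exact inv_mem (by omega)
  · rw [h1]; simpa using zero_mem'

lemma T_small (f : ℂ → ℂ) {z : ℂ} (hz : z ∈ Xset) (h : ‖z‖ < 1 / 2) :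
    Tfun f z = -f (z / (1 - z)) := by
  have a1 : z ∉ Metric.sphere (0 : ℂ) 1 := by
    intro h'
    have : ‖z‖ = 1 := by simpa using h'
    linarith
  have a2 : z ≠ 2⁻¹ := by
    intro h'; rw [h', norm_half] at h; linarith
  unfold Tfun
  rw [if_neg a1, if_neg a2]
  split_ifs with h1 h2
  · have hs := h1.choose_spec
    generalize h1.choose = n at hs
    obtain ⟨hn, h5⟩ := hs
    have h3 : (n : ℂ) ≠ 0 := by exact_mod_cast (by omega : n ≠ 0)
    have h4 : (1 : ℂ) - (n : ℂ)⁻¹ = (n - 1) * (n : ℂ)⁻¹ := by field_simp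
    rw [h5, h4, div_eq_mul_inv, mul_inv, inv_inv, mul_comm ((n : ℂ)⁻¹), mul_assoc,
      mul_inv_cancel₀ h3, mul_one]
  · rw [h2]; simp
  · rcases Xset_cases hz with h' | h' | h' | h'
    · linarith
    · exact absurd h' a2
    · exact absurd h' h1
    · exact absurd h' h2

lemma X_trich {z : ℂ} (hz : z ∈ Xset) : ‖z‖ = 1 ∨ z = 2⁻¹ ∨ ‖z‖ ≤ 1 / 3 := by
  rcases Xset_cases hz with h1 | h1 | ⟨n, hn, h1⟩ | h1
  · exact Or.inl h1
  · exact Or.inr (Or.inl h1)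
  · right; right; rw [h1]; exact norm_inv_le hn
  · right; right; rw [h1]; simp

lemma X_compact : IsCompact Xset := by
  have h : Xset = Metric.sphere (0 : ℂ) 1 ∪
      insert 0 (Set.range fun n : ℕ => (((n + 2 : ℕ) : ℂ))⁻¹) := by
    ext z
    constructor
    · rintro ((h | ⟨n, hn, h⟩) | h)
      · exact Or.inl h
      · refine Or.inr (Or.inr ⟨n - 2, ?_⟩)
        simp only [Nat.sub_add_cancel hn]; exact h.symm
      · exact Or.inr (Or.inl h)
    · rintro (h | h | ⟨n, h⟩)
      · exact Or.inl (Or.inl h)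
      · exact Or.inr h
      · exact Or.inl (Or.inr ⟨n + 2, by omega, h.symm⟩)
  rw [h]
  refine (isCompact_sphere _ _).union (Filter.Tendsto.isCompact_insert_range ?_)
  exact (tendsto_inv_atTop_nhds_zero_nat (𝕜 := ℂ)).comp (Filter.tendsto_add_atTop_nat 2)

lemma T_cont (f : ℂ → ℂ) (hf : ContinuousOn f Xset) : ContinuousOn (Tfun f) Xset := by
  intro z hz
  have hn : ContinuousWithinAt (fun w : ℂ => ‖w‖) Xset z := continuous_norm.continuousWithinAt
  rcases X_trich hz with h | h | h
  · have hev : ∀ᶠ w in nhdsWithin z Xset, ‖w‖ = 1 := by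
      have h1 := hn.eventually (lt_mem_nhds (show (1 / 2 : ℝ) < ‖z‖ by linarith))
      filter_upwards [h1, self_mem_nhdsWithin] with w hw hwX
      rcases X_trich hwX with h' | h' | h'
      · exact h'
      · rw [h', norm_half] at hw; linarith
      · linarith
    set c := Complex.exp (Complex.I * Real.sqrt 2) with hc
    have hzc : z * c ∈ Xset := mem_of_norm (by rw [norm_mul, h, norm_rot, one_mul])
    have ht : Filter.Tendsto (fun w => w * c) (nhdsWithin z Xset) (nhdsWithin (z * c) Xset) := by
      refine tendsto_nhdsWithin_iff.2
        ⟨(continuous_id.mul continuous_const).continuousWithinAt, ?_⟩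
      filter_upwards [hev] with w hw
      exact mem_of_norm (by rw [norm_mul, hw, norm_rot, one_mul])
    have h2 : Filter.Tendsto (fun w => f (w * c)) (nhdsWithin z Xset) (nhds (f (z * c))) :=
      Filter.Tendsto.comp (hf _ hzc) ht
    refine ContinuousWithinAt.congr_of_eventuallyEq h2 ?_ (T_circle f h)
    filter_upwards [hev] with w hw
    exact T_circle f hw
  · have hzn : ‖z‖ = 1 / 2 := by rw [h, norm_half]
    refine ContinuousWithinAt.congr_of_eventuallyEq
      (f := fun _ => Tfun f 2⁻¹) continuousWithinAt_const ?_ (by rw [h])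
    have h1 := hn.eventually (lt_mem_nhds (show (1 / 3 : ℝ) < ‖z‖ by linarith))
    have h2 := hn.eventually (gt_mem_nhds (show ‖z‖ < 1 by linarith))
    filter_upwards [h1, h2, self_mem_nhdsWithin] with w hw hw2 hwX
    rcases X_trich hwX with h' | h' | h'
    · linarith
    · rw [h']
    · linarith
  · have hlt : ‖z‖ < 1 / 2 := by linarith
    have hev := hn.eventually (gt_mem_nhds hlt)
    have hne : 1 - z ≠ 0 := by
      intro h0
      have : z = 1 := (sub_eq_zero.1 h0).symm
      rw [this] at h; norm_num at h
    have ht : Filter.Tendsto (fun w : ℂ => w / (1 - w)) (nhdsWithin z Xset)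
        (nhdsWithin (z / (1 - z)) Xset) := by
      refine tendsto_nhdsWithin_iff.2 ⟨?_, ?_⟩
      · have : ContinuousAt (fun w : ℂ => w / (1 - w)) z :=
          continuousAt_id.div (continuousAt_const.sub continuousAt_id) hne
        exact this.continuousWithinAt
      · filter_upwards [hev, self_mem_nhdsWithin] with w hw hwX
        exact small_mem hwX hw
    have h2 : Filter.Tendsto (fun w => -f (w / (1 - w))) (nhdsWithin z Xset)
        (nhds (-f (z / (1 - z)))) :=
      (Filter.Tendsto.comp (hf _ (small_mem hz hlt)) ht).neg
    refine ContinuousWithinAt.congr_of_eventuallyEq h2 ?_ (T_small f hz hlt)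
    filter_upwards [hev, self_mem_nhdsWithin] with w hw hwX
    exact T_small f hwX hw

lemma T_sup (f : ℂ → ℂ) (hf : ContinuousOn f Xset) :
    (⨆ z : Xset, ‖Tfun f (z : ℂ)‖) = ⨆ z : Xset, ‖f (z : ℂ)‖ := by
  have hb : BddAbove (Set.range fun z : Xset => ‖f (z : ℂ)‖) := by
    obtain ⟨C, hC⟩ := X_compact.exists_bound_of_continuousOn hf
    exact ⟨C, by rintro _ ⟨z, rfl⟩; exact hC z z.2⟩
  have hle : ∀ w ∈ Xset, ‖f w‖ ≤ ⨆ z : Xset, ‖f (z : ℂ)‖ := fun w hw => le_ciSup hb ⟨w, hw⟩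
  have hT : ∀ w ∈ Xset, ‖Tfun f w‖ ≤ ⨆ z : Xset, ‖f (z : ℂ)‖ := by
    intro w hw
    rcases X_trich hw with h | h | h
    · rw [T_circle f h]
      exact hle _ (mem_of_norm (by rw [norm_mul, h, norm_rot, one_mul]))
    · rw [h, T_half]
      have h1 := hle 1 (mem_of_norm (by simp))
      have h2 := hle _ (mem_of_norm norm_rot')
      refine (norm_sub_le _ _).trans ?_
      rw [norm_div, norm_div, norm_neg]
      have h3 : ‖(2 : ℂ)‖ = 2 := by simp
      rw [h3]; linarith
    · rw [T_small f hw (by linarith), norm_neg]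
      exact hle _ (small_mem hw (by linarith))
  have hb' : BddAbove (Set.range fun z : Xset => ‖Tfun f (z : ℂ)‖) :=
    ⟨_, by rintro _ ⟨z, rfl⟩; exact hT z z.2⟩
  have hle' : ∀ w ∈ Xset, ‖Tfun f w‖ ≤ ⨆ z : Xset, ‖Tfun f (z : ℂ)‖ :=
    fun w hw => le_ciSup hb' ⟨w, hw⟩
  haveI : Nonempty Xset := ⟨⟨0, zero_mem'⟩⟩
  apply le_antisymm
  · exact ciSup_le fun z => hT z z.2
  · refine ciSup_le ?_
    rintro ⟨z, hz⟩
    show ‖f z‖ ≤ _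
    rcases hz with (h | ⟨n, hn, h⟩) | h
    · have h1 : ‖z‖ = 1 := by simpa using h
      set c := Complex.exp (Complex.I * Real.sqrt 2) with hc
      have h2 : ‖z * c⁻¹‖ = 1 := by rw [norm_mul, norm_inv, h1, norm_rot]; simp
      have h3 := hle' _ (mem_of_norm h2)
      rw [T_circle f h2, ← hc, inv_mul_cancel_right₀ (Complex.exp_ne_zero _)] at h3
      exact h3
    · have hX : ((n + 1 : ℕ) : ℂ)⁻¹ ∈ Xset := inv_mem (by omega)
      have hlt : ‖((n + 1 : ℕ) : ℂ)⁻¹‖ < 1 / 2 :=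
        (norm_inv_le (by omega)).trans_lt (by norm_num)
      have h3 := hle' _ hX
      rw [T_small f hX hlt, norm_neg] at h3
      have h5 : (n : ℂ) ≠ 0 := by exact_mod_cast (by omega : n ≠ 0)
      have h6 : (n : ℂ) + 1 ≠ 0 := by exact_mod_cast (by omega : n + 1 ≠ 0)
      have h4 : ((n + 1 : ℕ) : ℂ)⁻¹ / (1 - ((n + 1 : ℕ) : ℂ)⁻¹) = z := by
        rw [h]; push_cast
        have h7 : (1 : ℂ) - ((n : ℂ) + 1)⁻¹ = n * ((n : ℂ) + 1)⁻¹ := by field_simp; ring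
        rw [h7]; field_simp
      rw [h4] at h3; exact h3
    · have h0 : z = 0 := h
      have h3 := hle' _ zero_mem'
      rw [T_small f zero_mem' (by simp), norm_neg] at h3
      rw [h0]; simpa using h3

/-- `T` maps continuous functions on `X` to continuous functions on `X`, is linear,
and preserves the supremum norm. -/
theorem stmt_10 :
    (∀ f : ℂ → ℂ, ContinuousOn f Xset → ContinuousOn (Tfun f) Xset) ∧
    (∀ f g : ℂ → ℂ, ∀ z ∈ Xset, Tfun (f + g) z = Tfun f z + Tfun g z) ∧
    (∀ (c : ℂ) (f : ℂ → ℂ), ∀ z ∈ Xset, Tfun (c • f) z = c * Tfun f z) ∧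
    (∀ f : ℂ → ℂ, ContinuousOn f Xset →
      (⨆ z : Xset, ‖Tfun f (z : ℂ)‖) = ⨆ z : Xset, ‖f (z : ℂ)‖) := by
  refine ⟨T_cont, ?_, ?_, T_sup⟩
  · intro f g z hz
    rcases X_trich hz with h | h | h
    · simp only [T_circle _ h, Pi.add_apply]
    · rw [h]; simp only [T_half, Pi.add_apply]; ring
    · simp only [T_small _ hz (show ‖z‖ < 1 / 2 by linarith), Pi.add_apply]; ring
  · intro c f z hz
    rcases X_trich hz with h | h | h
    · simp only [T_circle _ h, Pi.smul_apply, smul_eq_mul]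
    · rw [h]; simp only [T_half, Pi.smul_apply, smul_eq_mul]; ring
    · simp only [T_small _ hz (show ‖z‖ < 1 / 2 by linarith), Pi.smul_apply, smul_eq_mul]; ring
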